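/- For n = 8, the polynomial x_1x_2⋯x_8 + 1/80 belongs to the degree-8 truncated quadratic module M_{8,8}(g): there exist sums of squares σ_0, σ_1, …, σ_8 ∈ ℝ[x_1,…,x_8] with deg σ_0 ≤ 8 and deg σ_i ≤ 6 for i = 1,…,8 such that x_1x_2⋯x_8 + 1/80 = σ_0 + Σ_{i=1}^8 σ_i·(x_i - x_i²). -/

import Mathlib

open MvPolynomial

/-- A polynomial is a sum of squares. -/
def IsSOS {n : ℕ} (p : MvPolynomial (Fin n) ℝ) : Prop :=
  ∃ (k : ℕ) (q : Fin k → MvPolynomial (Fin n) ℝ), p = ∑ j, (q j) ^ 2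

/-- Membership in the degree-`2d` truncated quadratic module `M_{n,2d}(g)` of the
hypercube, where `g_i = x_i - x_i^2`. -/
def InQuadModule (n d : ℕ) (p : MvPolynomial (Fin n) ℝ) : Prop :=
  ∃ (σ₀ : MvPolynomial (Fin n) ℝ) (σ : Fin n → MvPolynomial (Fin n) ℝ),
    IsSOS σ₀ ∧ (∀ i, IsSOS (σ i)) ∧
    σ₀.totalDegree ≤ 2 * d ∧ (∀ i, (σ i).totalDegree ≤ 2 * d - 2) ∧
    p = σ₀ + ∑ i, σ i * (X i - (X i) ^ 2)


/-- A sum of squares of polynomials of degree at most `d`. -/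
def SOSd (d : ℕ) (p : MvPolynomial (Fin 8) ℝ) : Prop :=
  ∃ (k : ℕ) (q : Fin k → MvPolynomial (Fin 8) ℝ),
    p = ∑ j, (q j) ^ 2 ∧ ∀ j, (q j).totalDegree ≤ d

lemma SOSd.isSOS {d : ℕ} {p : MvPolynomial (Fin 8) ℝ} (h : SOSd d p) : IsSOS p := by
  obtain ⟨k, q, hq, -⟩ := h
  exact ⟨k, q, hq⟩

lemma SOSd.degree {d : ℕ} {p : MvPolynomial (Fin 8) ℝ} (h : SOSd d p) :
    p.totalDegree ≤ 2 * d := by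
  obtain ⟨k, q, rfl, hd⟩ := h
  refine totalDegree_finsetSum_le fun j _ => ?_
  refine (totalDegree_pow _ _).trans ?_
  exact Nat.mul_le_mul_left 2 (hd j)

lemma SOSd.zero (d : ℕ) : SOSd d 0 := ⟨0, fun _ => 0, by simp, by simp⟩

lemma SOSd.sq {d : ℕ} {p : MvPolynomial (Fin 8) ℝ} (h : p.totalDegree ≤ d) :
    SOSd d (p ^ 2) := ⟨1, fun _ => p, by simp, fun _ => h⟩

lemma SOSd.add {d : ℕ} {p q : MvPolynomial (Fin 8) ℝ} (hp : SOSd d p) (hq : SOSd d q) :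
    SOSd d (p + q) := by
  obtain ⟨k, f, rfl, hf⟩ := hp
  obtain ⟨l, g, rfl, hg⟩ := hq
  refine ⟨k + l, Fin.append f g, ?_, ?_⟩
  · rw [Fin.sum_univ_add]; simp
  · intro j
    refine Fin.addCases (fun i => ?_) (fun i => ?_) j
    · simpa using hf i
    · simpa using hg i

lemma SOSd.sum {d : ℕ} {ι : Type*} (s : Finset ι) (f : ι → MvPolynomial (Fin 8) ℝ)
    (h : ∀ i ∈ s, SOSd d (f i)) : SOSd d (∑ i ∈ s, f i) := by
  classical
  induction s using Finset.induction_on with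
  | empty => simpa using SOSd.zero d
  | insert a s ha ih =>
    rw [Finset.sum_insert ha]
    exact (h a (by simp)).add (ih fun i hi => h i (by simp [hi]))

lemma deg_C_mul {d : ℕ} (c : ℝ) {p : MvPolynomial (Fin 8) ℝ} (h : p.totalDegree ≤ d) :
    (C c * p).totalDegree ≤ d := by
  refine (totalDegree_mul _ _).trans ?_
  simpa using h

lemma deg_add {d : ℕ} {p q : MvPolynomial (Fin 8) ℝ} (hp : p.totalDegree ≤ d)
    (hq : q.totalDegree ≤ d) : (p + q).totalDegree ≤ d :=
  (totalDegree_add _ _).trans (max_le hp hq)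

lemma deg_mul {d e f : ℕ} {p q : MvPolynomial (Fin 8) ℝ} (hp : p.totalDegree ≤ d)
    (hq : q.totalDegree ≤ e) (h : d + e ≤ f) : (p * q).totalDegree ≤ f :=
  (totalDegree_mul _ _).trans ((Nat.add_le_add hp hq).trans h)

lemma SOSd.smul {d : ℕ} {p : MvPolynomial (Fin 8) ℝ} (c : ℝ) (hc : 0 ≤ c) (hp : SOSd d p) :
    SOSd d (C c * p) := by
  obtain ⟨k, f, rfl, hf⟩ := hp
  refine ⟨k, fun j => C (Real.sqrt c) * f j, ?_, fun j => deg_C_mul _ (hf j)⟩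
  rw [Finset.mul_sum]
  refine Finset.sum_congr rfl fun j _ => ?_
  rw [mul_pow, ← C_pow, Real.sq_sqrt hc]

/-- Power means. -/
noncomputable def PM (k : ℕ) : MvPolynomial (Fin 8) ℝ := C (1 / 8) * ∑ i, X i ^ k

lemma deg_PM (k : ℕ) : (PM k).totalDegree ≤ k := by
  refine deg_C_mul _ (totalDegree_finsetSum_le fun j _ => ?_)
  simp [totalDegree_X_pow]

/-- Real power means. -/
noncomputable def pm (x : Fin 8 → ℝ) (k : ℕ) : ℝ := 1 / 8 * ∑ i, x i ^ k

lemma eval_PM (x : Fin 8 → ℝ) (k : ℕ) : eval x (PM k) = pm x k := by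
  simp [PM, pm]

/-- The Newton identities for eight variables. -/
lemma newton (x : Fin 8 → ℝ) : ∃ e : ℕ → ℝ, e 0 = 1 ∧ e 8 = ∏ i, x i ∧
    ∀ k : ℕ, (k : ℝ) * e k = (-1) ^ (k + 1) *
      ∑ a ∈ Finset.HasAntidiagonal.antidiagonal k with a.1 < k, (-1) ^ a.1 * e a.1 * (8 * pm x a.2) := by
  refine ⟨fun k => eval x (esymm (Fin 8) ℝ k), by simp, ?_, ?_⟩
  · have : Finset.powersetCard 8 (Finset.univ : Finset (Fin 8)) = {Finset.univ} := by
      have := Finset.powersetCard_self (Finset.univ : Finset (Fin 8))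
      simpa using this
    simp [esymm, this]
  · intro k
    have h := congrArg (eval x) (mul_esymm_eq_sum (Fin 8) ℝ k)
    simp only [map_mul, map_sum, map_pow, map_neg, map_one, map_natCast, psum, eval_X] at h
    rw [h]
    congr 1
    refine Finset.sum_congr rfl fun a _ => ?_
    simp only [pm]
    ring

section
variable {A : Type*} [CommRing A]

def L1 (y : Fin 8 → A) (R : Finset (Fin 8)) (t : A) : A :=
  ∑ e ∈ R, ∑ f ∈ R, (t * (y e - y f)) ^ 2

def L2 (y : Fin 8 → A) (R : Finset (Fin 8)) (t : A) : A :=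
  ∑ c ∈ R, ∑ d ∈ R, L1 y (R \ {c, d}) (t * (y c - y d))

def L3 (y : Fin 8 → A) (R : Finset (Fin 8)) (t : A) : A :=
  ∑ a ∈ R, ∑ b ∈ R, L2 y (R \ {a, b}) (t * (y a - y b))
end

lemma deg_diff (a b : Fin 8) : (X a - X b : MvPolynomial (Fin 8) ℝ).totalDegree ≤ 1 := by
  refine (totalDegree_sub _ _).trans ?_
  simp

lemma sos_L1 (R : Finset (Fin 8)) (t : MvPolynomial (Fin 8) ℝ) (d : ℕ)
    (h : t.totalDegree ≤ d) : SOSd (d + 1) (L1 X R t) :=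
  SOSd.sum _ _ fun _ _ => SOSd.sum _ _ fun _ _ => SOSd.sq (deg_mul h (deg_diff _ _) le_rfl)

lemma sos_L2 (R : Finset (Fin 8)) (t : MvPolynomial (Fin 8) ℝ) (d : ℕ)
    (h : t.totalDegree ≤ d) : SOSd (d + 2) (L2 X R t) :=
  SOSd.sum _ _ fun _ _ => SOSd.sum _ _ fun _ _ =>
    sos_L1 _ _ (d + 1) (deg_mul h (deg_diff _ _) le_rfl)

lemma sos_L3 (R : Finset (Fin 8)) (t : MvPolynomial (Fin 8) ℝ) (d : ℕ)
    (h : t.totalDegree ≤ d) : SOSd (d + 3) (L3 X R t) :=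
  SOSd.sum _ _ fun _ _ => SOSd.sum _ _ fun _ _ =>
    sos_L2 _ _ (d + 1) (deg_mul h (deg_diff _ _) le_rfl)

lemma eval_L1 (x : Fin 8 → ℝ) (R : Finset (Fin 8)) (t : MvPolynomial (Fin 8) ℝ) :
    eval x (L1 X R t) = L1 x R (eval x t) := by
  simp [L1]

lemma eval_L2 (x : Fin 8 → ℝ) (R : Finset (Fin 8)) (t : MvPolynomial (Fin 8) ℝ) :
    eval x (L2 X R t) = L2 x R (eval x t) := by
  simp [L2, eval_L1]

lemma eval_L3 (x : Fin 8 → ℝ) (R : Finset (Fin 8)) (t : MvPolynomial (Fin 8) ℝ) :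
    eval x (L3 X R t) = L3 x R (eval x t) := by
  simp [L3, eval_L2]

/-- Partial power sums. -/
def qs (x : Fin 8 → ℝ) (R : Finset (Fin 8)) (k : ℕ) : ℝ := ∑ i ∈ R, x i ^ k

lemma hterm (x : Fin 8 → ℝ) (R : Finset (Fin 8)) (K : ℝ) (i j : ℕ) :
    ∑ c ∈ R, ∑ d ∈ R, K * x c ^ i * x d ^ j = K * qs x R i * qs x R j := by
  simp only [qs, ← Finset.mul_sum, ← Finset.sum_mul]

lemma qs_sdiff (x : Fin 8 → ℝ) (R : Finset (Fin 8)) (a b : Fin 8) (ha : a ∈ R) (hb : b ∈ R)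
    (hab : a ≠ b) (k : ℕ) : qs x (R \ {a, b}) k = qs x R k - x a ^ k - x b ^ k := by
  have hsub : ({a, b} : Finset (Fin 8)) ⊆ R := by
    intro i hi
    simp only [Finset.mem_insert, Finset.mem_singleton] at hi
    rcases hi with rfl | rfl <;> assumption
  have h := Finset.sum_sdiff (f := fun i => x i ^ k) hsub
  rw [Finset.sum_pair hab] at h
  simp only [qs]
  linarith

lemma L1_eq (x : Fin 8 → ℝ) (R : Finset (Fin 8)) (t : ℝ) :
    L1 x R t = t ^ 2 * (2 * (qs x R 0 * qs x R 2 - qs x R 1 ^ 2)) := by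
  have h : L1 x R t = ∑ c ∈ R, ∑ d ∈ R, (t ^ 2 * x c ^ 2 * x d ^ 0 +
      (-2 * t ^ 2) * x c ^ 1 * x d ^ 1 + t ^ 2 * x c ^ 0 * x d ^ 2) := by
    refine Finset.sum_congr rfl fun c _ => Finset.sum_congr rfl fun d _ => ?_
    ring
  rw [h]
  simp only [Finset.sum_add_distrib, hterm]
  ring

def polyL2 (N q1 q2 q3 q4 q5 q6 : ℝ) : ℝ :=
  (4)*N^2*q2^2 + (-4)*N^2*q4 + (-8)*N*q1^2*q2 + (16)*N*q1*q3 + (-12)*N*q2^2 + (4)*N*q4 + (4)*q1^4 + (-16)*q1*q3 + (12)*q2^2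

lemma L2_eq (x : Fin 8 → ℝ) (R : Finset (Fin 8)) (t : ℝ) :
    L2 x R t = t ^ 2 * polyL2 (qs x R 0) (qs x R 1) (qs x R 2) (qs x R 3) (qs x R 4)
      (qs x R 5) (qs x R 6) := by
  generalize hN : qs x R 0 = N
  generalize h1 : qs x R 1 = q1
  generalize h2 : qs x R 2 = q2
  generalize h3 : qs x R 3 = q3
  generalize h4 : qs x R 4 = q4
  generalize h5 : qs x R 5 = q5
  generalize h6 : qs x R 6 = q6
  have h : L2 x R t = ∑ c ∈ R, ∑ d ∈ R, (
      (t^2*((2)*N*q2 + (-2)*q1^2 + (-4)*q2)) * x c ^ 0 * x d ^ 2 +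
      (t^2*((4)*q1)) * x c ^ 0 * x d ^ 3 +
      (t^2*((-2)*N + (2))) * x c ^ 0 * x d ^ 4 +
      (t^2*((-4)*N*q2 + (4)*q1^2 + (8)*q2)) * x c ^ 1 * x d ^ 1 +
      (t^2*((-4)*q1)) * x c ^ 1 * x d ^ 2 +
      (t^2*((4)*N + (-8))) * x c ^ 1 * x d ^ 3 +
      (t^2*((2)*N*q2 + (-2)*q1^2 + (-4)*q2)) * x c ^ 2 * x d ^ 0 +
      (t^2*((-4)*q1)) * x c ^ 2 * x d ^ 1 +
      (t^2*((-4)*N + (12))) * x c ^ 2 * x d ^ 2 +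
      (t^2*((4)*q1)) * x c ^ 3 * x d ^ 0 +
      (t^2*((4)*N + (-8))) * x c ^ 3 * x d ^ 1 +
      (t^2*((-2)*N + (2))) * x c ^ 4 * x d ^ 0) := by
    refine Finset.sum_congr rfl fun c hc => Finset.sum_congr rfl fun d hd => ?_
    rw [L1_eq]
    by_cases hcd : c = d
    · subst hcd
      ring
    · simp only [qs_sdiff x R c d hc hd hcd, hN, h1, h2, h3, h4, h5, h6]
      ring
  rw [h]
  simp only [Finset.sum_add_distrib, hterm, hN, h1, h2, h3, h4, h5, h6, polyL2]
  ring

def polyL3 (N q1 q2 q3 q4 q5 q6 : ℝ) : ℝ :=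
  (8)*N^3*q2^3 + (-24)*N^3*q2*q4 + (16)*N^3*q6 + (-24)*N^2*q1^2*q2^2 + (24)*N^2*q1^2*q4 + (96)*N^2*q1*q2*q3 + (-96)*N^2*q1*q5 + (-72)*N^2*q2^3 + (168)*N^2*q2*q4 + (-48)*N^2*q3^2 + (-48)*N^2*q6 + (24)*N*q1^4*q2 + (-96)*N*q1^3*q3 + (72)*N*q1^2*q2^2 + (72)*N*q1^2*q4 + (-384)*N*q1*q2*q3 + (288)*N*q1*q5 + (232)*N*q2^3 + (-480)*N*q2*q4 + (240)*N*q3^2 + (32)*N*q6 + (-8)*q1^6 + (160)*q1^3*q3 + (-120)*q1^2*q2^2 + (-240)*q1^2*q4 + (480)*q1*q2*q3 + (-192)*q1*q5 + (-240)*q2^3 + (480)*q2*q4 + (-320)*q3^2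

lemma L3_eq (x : Fin 8 → ℝ) (R : Finset (Fin 8)) (t : ℝ) :
    L3 x R t = t ^ 2 * polyL3 (qs x R 0) (qs x R 1) (qs x R 2) (qs x R 3) (qs x R 4)
      (qs x R 5) (qs x R 6) := by
  generalize hN : qs x R 0 = N
  generalize h1 : qs x R 1 = q1
  generalize h2 : qs x R 2 = q2
  generalize h3 : qs x R 3 = q3
  generalize h4 : qs x R 4 = q4
  generalize h5 : qs x R 5 = q5
  generalize h6 : qs x R 6 = q6
  have h : L3 x R t = ∑ c ∈ R, ∑ d ∈ R, (
      (t^2*((4)*N^2*q2^2 + (-4)*N^2*q4 + (-8)*N*q1^2*q2 + (16)*N*q1*q3 + (-28)*N*q2^2 + (20)*N*q4 + (4)*q1^4 + (16)*q1^2*q2 + (-48)*q1*q3 + (52)*q2^2 + (-24)*q4)) * x c ^ 0 * x d ^ 2 +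
      (t^2*((16)*N*q1*q2 + (-16)*N*q3 + (-16)*q1^3 + (-32)*q1*q2 + (48)*q3)) * x c ^ 0 * x d ^ 3 +
      (t^2*((-8)*N^2*q2 + (8)*N*q1^2 + (48)*N*q2 + (8)*q1^2 + (-88)*q2)) * x c ^ 0 * x d ^ 4 +
      (t^2*((-32)*N*q1 + (64)*q1)) * x c ^ 0 * x d ^ 5 +
      (t^2*((8)*N^2 + (-24)*N + (16))) * x c ^ 0 * x d ^ 6 +
      (t^2*((-8)*N^2*q2^2 + (8)*N^2*q4 + (16)*N*q1^2*q2 + (-32)*N*q1*q3 + (56)*N*q2^2 + (-40)*N*q4 + (-8)*q1^4 + (-32)*q1^2*q2 + (96)*q1*q3 + (-104)*q2^2 + (48)*q4)) * x c ^ 1 * x d ^ 1 +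
      (t^2*((-16)*N*q1*q2 + (16)*N*q3 + (16)*q1^3 + (32)*q1*q2 + (-48)*q3)) * x c ^ 1 * x d ^ 2 +
      (t^2*((16)*N^2*q2 + (-16)*N*q1^2 + (-112)*N*q2 + (32)*q1^2 + (208)*q2)) * x c ^ 1 * x d ^ 3 +
      (t^2*((48)*N*q1 + (-144)*q1)) * x c ^ 1 * x d ^ 4 +
      (t^2*((-16)*N^2 + (80)*N + (-96))) * x c ^ 1 * x d ^ 5 +
      (t^2*((4)*N^2*q2^2 + (-4)*N^2*q4 + (-8)*N*q1^2*q2 + (16)*N*q1*q3 + (-28)*N*q2^2 + (20)*N*q4 + (4)*q1^4 + (16)*q1^2*q2 + (-48)*q1*q3 + (52)*q2^2 + (-24)*q4)) * x c ^ 2 * x d ^ 0 +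
      (t^2*((-16)*N*q1*q2 + (16)*N*q3 + (16)*q1^3 + (32)*q1*q2 + (-48)*q3)) * x c ^ 2 * x d ^ 1 +
      (t^2*((-16)*N^2*q2 + (16)*N*q1^2 + (128)*N*q2 + (-80)*q1^2 + (-240)*q2)) * x c ^ 2 * x d ^ 2 +
      (t^2*((-16)*N*q1 + (80)*q1)) * x c ^ 2 * x d ^ 3 +
      (t^2*((16)*N^2 + (-128)*N + (240))) * x c ^ 2 * x d ^ 4 +
      (t^2*((16)*N*q1*q2 + (-16)*N*q3 + (-16)*q1^3 + (-32)*q1*q2 + (48)*q3)) * x c ^ 3 * x d ^ 0 +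
      (t^2*((16)*N^2*q2 + (-16)*N*q1^2 + (-112)*N*q2 + (32)*q1^2 + (208)*q2)) * x c ^ 3 * x d ^ 1 +
      (t^2*((-16)*N*q1 + (80)*q1)) * x c ^ 3 * x d ^ 2 +
      (t^2*((-16)*N^2 + (144)*N + (-320))) * x c ^ 3 * x d ^ 3 +
      (t^2*((-8)*N^2*q2 + (8)*N*q1^2 + (48)*N*q2 + (8)*q1^2 + (-88)*q2)) * x c ^ 4 * x d ^ 0 +
      (t^2*((48)*N*q1 + (-144)*q1)) * x c ^ 4 * x d ^ 1 +
      (t^2*((16)*N^2 + (-128)*N + (240))) * x c ^ 4 * x d ^ 2 +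
      (t^2*((-32)*N*q1 + (64)*q1)) * x c ^ 5 * x d ^ 0 +
      (t^2*((-16)*N^2 + (80)*N + (-96))) * x c ^ 5 * x d ^ 1 +
      (t^2*((8)*N^2 + (-24)*N + (16))) * x c ^ 6 * x d ^ 0) := by
    refine Finset.sum_congr rfl fun c hc => Finset.sum_congr rfl fun d hd => ?_
    rw [L2_eq]
    by_cases hcd : c = d
    · subst hcd
      ring
    · simp only [polyL2, qs_sdiff x R c d hc hd hcd, hN, h1, h2, h3, h4, h5, h6]
      ring
  rw [h]
  simp only [Finset.sum_add_distrib, hterm, hN, h1, h2, h3, h4, h5, h6, polyL3]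
  ring

lemma qs_univ (x : Fin 8 → ℝ) (k : ℕ) : qs x Finset.univ k = 8 * pm x k := by
  simp only [qs, pm]
  ring

lemma pm_zero (x : Fin 8 → ℝ) : pm x 0 = 1 := by
  simp [pm]

lemma prod_eq (x : Fin 8 → ℝ) : ∃ e1 e2 e3 e4 e5 e6 e7 : ℝ,
    e1 = 8 * pm x 1 ∧
    2 * e2 = 8 * (e1 * pm x 1 - pm x 2) ∧
    3 * e3 = 8 * (e2 * pm x 1 - e1 * pm x 2 + pm x 3) ∧
    4 * e4 = 8 * (e3 * pm x 1 - e2 * pm x 2 + e1 * pm x 3 - pm x 4) ∧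
    5 * e5 = 8 * (e4 * pm x 1 - e3 * pm x 2 + e2 * pm x 3 - e1 * pm x 4 + pm x 5) ∧
    6 * e6 = 8 * (e5 * pm x 1 - e4 * pm x 2 + e3 * pm x 3 - e2 * pm x 4 + e1 * pm x 5
      - pm x 6) ∧
    7 * e7 = 8 * (e6 * pm x 1 - e5 * pm x 2 + e4 * pm x 3 - e3 * pm x 4 + e2 * pm x 5
      - e1 * pm x 6 + pm x 7) ∧
    8 * ∏ i, x i = 8 * (e7 * pm x 1 - e6 * pm x 2 + e5 * pm x 3 - e4 * pm x 4 + e3 * pm x 5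
      - e2 * pm x 6 + e1 * pm x 7 - pm x 8) := by
  obtain ⟨e, h0, h8, h⟩ := newton x
  rw [← h8]
  refine ⟨e 1, e 2, e 3, e 4, e 5, e 6, e 7, ?_, ?_, ?_, ?_, ?_, ?_, ?_, ?_⟩
  · have := h 1
    simp [Finset.sum_filter, Finset.Nat.antidiagonal_succ, h0] at this
    linarith
  · have := h 2
    have hf : (Finset.HasAntidiagonal.antidiagonal 2).filter (fun a : ℕ × ℕ => a.1 < 2) =
        {(0, 2), (1, 1)} := by decide
    rw [hf, Finset.sum_pair (by decide)] at this
    simp [h0] at this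
    linarith
  · have := h 3
    simp [Finset.sum_filter, Finset.Nat.antidiagonal_succ, h0] at this
    linarith
  · have := h 4
    simp [Finset.sum_filter, Finset.Nat.antidiagonal_succ, h0] at this
    linarith
  · have := h 5
    simp [Finset.sum_filter, Finset.Nat.antidiagonal_succ, h0] at this
    linarith
  · have := h 6
    simp [Finset.sum_filter, Finset.Nat.antidiagonal_succ, h0] at this
    linarith
  · have := h 7
    simp [Finset.sum_filter, Finset.Nat.antidiagonal_succ, h0] at this
    linarith
  · have := h 8
    simp [Finset.sum_filter, Finset.Nat.antidiagonal_succ, h0] at this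
    linarith

lemma sumB (x : Fin 8 → ℝ) (r0 r1 r2 r3 : ℝ) :
    1 / 8 * ∑ i, (r0 + r1 * x i + r2 * x i ^ 2 + r3 * x i ^ 3) ^ 2 * (x i - x i ^ 2) =
      r0 ^ 2 * (pm x 1 - pm x 2) + 2 * r0 * r1 * (pm x 2 - pm x 3) +
      (r1 ^ 2 + 2 * r0 * r2) * (pm x 3 - pm x 4) +
      (2 * r0 * r3 + 2 * r1 * r2) * (pm x 4 - pm x 5) +
      (r2 ^ 2 + 2 * r1 * r3) * (pm x 5 - pm x 6) +
      2 * r2 * r3 * (pm x 6 - pm x 7) + r3 ^ 2 * (pm x 7 - pm x 8) := by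
  have h : ∀ i, (r0 + r1 * x i + r2 * x i ^ 2 + r3 * x i ^ 3) ^ 2 * (x i - x i ^ 2) =
      r0 ^ 2 * x i ^ 1 + (2 * r0 * r1 - r0 ^ 2) * x i ^ 2 +
      (r1 ^ 2 + 2 * r0 * r2 - 2 * r0 * r1) * x i ^ 3 +
      ((2 * r0 * r3 + 2 * r1 * r2) - (r1 ^ 2 + 2 * r0 * r2)) * x i ^ 4 +
      ((r2 ^ 2 + 2 * r1 * r3) - (2 * r0 * r3 + 2 * r1 * r2)) * x i ^ 5 +
      (2 * r2 * r3 - (r2 ^ 2 + 2 * r1 * r3)) * x i ^ 6 +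
      (r3 ^ 2 - 2 * r2 * r3) * x i ^ 7 + (-r3 ^ 2) * x i ^ 8 := by
    intro i
    ring
  simp only [h, Finset.sum_add_distrib, ← Finset.mul_sum, pm]
  ring

lemma deg_Xpow (i : Fin 8) (k : ℕ) : (X i ^ k : MvPolynomial (Fin 8) ℝ).totalDegree ≤ k := by
  simp [totalDegree_X_pow]

noncomputable def qA (a0 a1 a2 a3 a4 a5 a6 a7 a8 a9 a10 a11 : ℝ) : MvPolynomial (Fin 8) ℝ :=
  C a0 + C a1 * (PM 1) + C a2 * (PM 2) + C a3 * (PM 1 * PM 1) + C a4 * (PM 3) + C a5 * (PM 2 * PM 1) + C a6 * (PM 1 * PM 1 * PM 1) + C a7 * (PM 4) + C a8 * (PM 3 * PM 1) + C a9 * (PM 2 * PM 2) + C a10 * (PM 2 * PM 1 * PM 1) + C a11 * (PM 1 * PM 1 * PM 1 * PM 1)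

lemma deg_qA (a0 a1 a2 a3 a4 a5 a6 a7 a8 a9 a10 a11 : ℝ) :
    (qA a0 a1 a2 a3 a4 a5 a6 a7 a8 a9 a10 a11).totalDegree ≤ 4 :=
  (deg_add (deg_add (deg_add (deg_add (deg_add (deg_add (deg_add (deg_add (deg_add (deg_add (deg_add (by simp)
    (deg_C_mul _ ((deg_PM 1).trans (by norm_num))))
    (deg_C_mul _ ((deg_PM 2).trans (by norm_num))))
    (deg_C_mul _ (deg_mul (deg_PM 1) (deg_PM 1) (by norm_num))))
    (deg_C_mul _ ((deg_PM 3).trans (by norm_num))))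
    (deg_C_mul _ (deg_mul (deg_PM 2) (deg_PM 1) (by norm_num))))
    (deg_C_mul _ (deg_mul (deg_mul (deg_PM 1) (deg_PM 1) le_rfl) (deg_PM 1) (by norm_num))))
    (deg_C_mul _ ((deg_PM 4).trans (by norm_num))))
    (deg_C_mul _ (deg_mul (deg_PM 3) (deg_PM 1) (by norm_num))))
    (deg_C_mul _ (deg_mul (deg_PM 2) (deg_PM 2) (by norm_num))))
    (deg_C_mul _ (deg_mul (deg_mul (deg_PM 2) (deg_PM 1) le_rfl) (deg_PM 1) (by norm_num))))
    (deg_C_mul _ (deg_mul (deg_mul (deg_mul (deg_PM 1) (deg_PM 1) le_rfl) (deg_PM 1) le_rfl) (deg_PM 1) (by norm_num))))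

def rA (a0 a1 a2 a3 a4 a5 a6 a7 a8 a9 a10 a11 m1 m2 m3 m4 : ℝ) : ℝ :=
  a0 + a1*(m1) + a2*(m2) + a3*(m1*m1) + a4*(m3) + a5*(m2*m1) + a6*(m1*m1*m1) + a7*(m4) + a8*(m3*m1) + a9*(m2*m2) + a10*(m2*m1*m1) + a11*(m1*m1*m1*m1)

lemma eval_qA (x : Fin 8 → ℝ) (a0 a1 a2 a3 a4 a5 a6 a7 a8 a9 a10 a11 : ℝ) :
    eval x (qA a0 a1 a2 a3 a4 a5 a6 a7 a8 a9 a10 a11) = rA a0 a1 a2 a3 a4 a5 a6 a7 a8 a9 a10 a11 (pm x 1) (pm x 2) (pm x 3) (pm x 4) := by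
  simp only [qA, rA, map_add, map_mul, eval_C, eval_PM]

noncomputable def qB (a0 a1 a2 a3 a4 a5 a6 a7 a8 a9 a10 a11 a12 a13 : ℝ) (i : Fin 8) : MvPolynomial (Fin 8) ℝ :=
  C a0 + C a1 * (PM 1) + C a2 * (X i ^ 1) + C a3 * (PM 2) + C a4 * (PM 1 * PM 1) + C a5 * (PM 1 * X i ^ 1) + C a6 * (X i ^ 2) + C a7 * (PM 3) + C a8 * (PM 2 * PM 1) + C a9 * (PM 1 * PM 1 * PM 1) + C a10 * (PM 2 * X i ^ 1) + C a11 * (PM 1 * PM 1 * X i ^ 1) + C a12 * (PM 1 * X i ^ 2) + C a13 * (X i ^ 3)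

lemma deg_qB (a0 a1 a2 a3 a4 a5 a6 a7 a8 a9 a10 a11 a12 a13 : ℝ) (i : Fin 8) :
    (qB a0 a1 a2 a3 a4 a5 a6 a7 a8 a9 a10 a11 a12 a13 i).totalDegree ≤ 3 :=
  (deg_add (deg_add (deg_add (deg_add (deg_add (deg_add (deg_add (deg_add (deg_add (deg_add (deg_add (deg_add (deg_add (by simp)
    (deg_C_mul _ ((deg_PM 1).trans (by norm_num))))
    (deg_C_mul _ ((deg_Xpow i 1).trans (by norm_num))))
    (deg_C_mul _ ((deg_PM 2).trans (by norm_num))))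
    (deg_C_mul _ (deg_mul (deg_PM 1) (deg_PM 1) (by norm_num))))
    (deg_C_mul _ (deg_mul (deg_PM 1) (deg_Xpow i 1) (by norm_num))))
    (deg_C_mul _ ((deg_Xpow i 2).trans (by norm_num))))
    (deg_C_mul _ ((deg_PM 3).trans (by norm_num))))
    (deg_C_mul _ (deg_mul (deg_PM 2) (deg_PM 1) (by norm_num))))
    (deg_C_mul _ (deg_mul (deg_mul (deg_PM 1) (deg_PM 1) le_rfl) (deg_PM 1) (by norm_num))))
    (deg_C_mul _ (deg_mul (deg_PM 2) (deg_Xpow i 1) (by norm_num))))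
    (deg_C_mul _ (deg_mul (deg_mul (deg_PM 1) (deg_PM 1) le_rfl) (deg_Xpow i 1) (by norm_num))))
    (deg_C_mul _ (deg_mul (deg_PM 1) (deg_Xpow i 2) (by norm_num))))
    (deg_C_mul _ ((deg_Xpow i 3).trans (by norm_num))))

def rB (a0 a1 a2 a3 a4 a5 a6 a7 a8 a9 a10 a11 a12 a13 m1 m2 m3 m4 m5 m6 m7 m8 : ℝ) : ℝ :=
  (a0 + a1*(m1) + a3*(m2) + a4*(m1*m1) + a7*(m3) + a8*(m2*m1) + a9*(m1*m1*m1)) ^ 2 * (m1 - m2) +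
  2 * (a0 + a1*(m1) + a3*(m2) + a4*(m1*m1) + a7*(m3) + a8*(m2*m1) + a9*(m1*m1*m1)) * (a2 + a5*(m1) + a10*(m2) + a11*(m1*m1)) * (m2 - m3) +
  ((a2 + a5*(m1) + a10*(m2) + a11*(m1*m1)) ^ 2 + 2 * (a0 + a1*(m1) + a3*(m2) + a4*(m1*m1) + a7*(m3) + a8*(m2*m1) + a9*(m1*m1*m1)) * (a6 + a12*(m1))) * (m3 - m4) +
  (2 * (a0 + a1*(m1) + a3*(m2) + a4*(m1*m1) + a7*(m3) + a8*(m2*m1) + a9*(m1*m1*m1)) * (a13) + 2 * (a2 + a5*(m1) + a10*(m2) + a11*(m1*m1)) * (a6 + a12*(m1))) * (m4 - m5) +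
  ((a6 + a12*(m1)) ^ 2 + 2 * (a2 + a5*(m1) + a10*(m2) + a11*(m1*m1)) * (a13)) * (m5 - m6) +
  2 * (a6 + a12*(m1)) * (a13) * (m6 - m7) + (a13) ^ 2 * (m7 - m8)

lemma eval_qB (x : Fin 8 → ℝ) (a0 a1 a2 a3 a4 a5 a6 a7 a8 a9 a10 a11 a12 a13 : ℝ) :
    1 / 8 * ∑ i, (eval x (qB a0 a1 a2 a3 a4 a5 a6 a7 a8 a9 a10 a11 a12 a13 i)) ^ 2 * (x i - x i ^ 2) =
      rB a0 a1 a2 a3 a4 a5 a6 a7 a8 a9 a10 a11 a12 a13 (pm x 1) (pm x 2) (pm x 3) (pm x 4) (pm x 5) (pm x 6) (pm x 7) (pm x 8) := by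
  rw [rB, ← sumB]
  congr 1
  refine Finset.sum_congr rfl fun i _ => ?_
  congr 2
  simp only [qB, map_add, map_mul, map_pow, eval_C, eval_PM, eval_X]
  ring

noncomputable def qC (a0 a1 a2 : ℝ) : MvPolynomial (Fin 8) ℝ :=
  C a0 + C a1 * (PM 1) + C a2 * (PM 1 * PM 1)

lemma deg_qC (a0 a1 a2 : ℝ) :
    (qC a0 a1 a2).totalDegree ≤ 2 :=
  (deg_add (deg_add (by simp)
    (deg_C_mul _ ((deg_PM 1).trans (by norm_num))))
    (deg_C_mul _ (deg_mul (deg_PM 1) (deg_PM 1) (by norm_num))))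

def rC (a0 a1 a2 m1 m2 m3 m4 : ℝ) : ℝ :=
  a0 + a1*(m1) + a2*(m1*m1)

lemma eval_qC (x : Fin 8 → ℝ) (a0 a1 a2 : ℝ) :
    eval x (qC a0 a1 a2) = rC a0 a1 a2 (pm x 1) (pm x 2) (pm x 3) (pm x 4) := by
  simp only [qC, rC, map_add, map_mul, eval_C, eval_PM]

noncomputable def qD (a0 a1 : ℝ) : MvPolynomial (Fin 8) ℝ :=
  C a0 + C a1 * (PM 1)

lemma deg_qD (a0 a1 : ℝ) :
    (qD a0 a1).totalDegree ≤ 1 :=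
  (deg_add (by simp)
    (deg_C_mul _ ((deg_PM 1).trans (by norm_num))))

def rD (a0 a1 m1 m2 m3 m4 : ℝ) : ℝ :=
  a0 + a1*(m1)

lemma eval_qD (x : Fin 8 → ℝ) (a0 a1 : ℝ) :
    eval x (qD a0 a1) = rD a0 a1 (pm x 1) (pm x 2) (pm x 3) (pm x 4) := by
  simp only [qD, rD, map_add, map_mul, eval_C, eval_PM]

noncomputable def sigA : MvPolynomial (Fin 8) ℝ :=
  C (1/80) * (qA (1) (-1355/128) (-325/128) (81875/2048) (-855/64) (4415/64) (-7415/64) (-16539168419/7096762368) (2575/64) (125/16) (-10665/64) (10265/64)) ^ 2 +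
  C (574107/262144) * (qA (0) (1) (-68875/574107) (-51777443/9185712) (-225382/191369) (1004918/191369) (3206158/574107) (-106261482514541/371355555594240) (2075074/574107) (181912/574107) (-2318746/191369) (713978/191369)) ^ 2 +
  C (79819264553/37624676352) * (qA (0) (0) (1) (-102778511840/79819264553) (-167138092074266133/537815819016949760) (-278297966592/79819264553) (391901704192/79819264553) (-2678261211514235/13445395475423744) (111810553024/79819264553) (21172444809156787/403361864262712320) (916968960/609307363) (-299841228096/79819264553)) ^ 2 +
  C (104452976187101909/20924141286981632) * (qA (0) (0) (0) (1) (-193190788712489967661/1099680933297808897952) (-737273996981776/104452976187101909) (-266429760411504944/104452976187101909) (2283952739357917371312293/12668324351590758504407040) (-78778096545321472/104452976187101909) (-860877016242050863343/2474282099920070020392) (296163332622081040/104452976187101909) (-19382213268521856/104452976187101909)) ^ 2 +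
  C (13984714936132415636580375457798776923/8391048168905480949794172071785267200) * (qA (0) (0) (0) (0) (1) (-39631331144168668133679512480655605760/13984714936132415636580375457798776923) (26957947230093780864892103406905425920/13984714936132415636580375457798776923) (-87919395897306942936691088291241240/208727088598991278157916051608936969) (-4537719847765396986283005044562411520/13984714936132415636580375457798776923) (-11154092663578775209125977918704842876/13984714936132415636580375457798776923) (80537280090564999054629702544968908800/13984714936132415636580375457798776923) (-63218677066795791123771745340475310080/13984714936132415636580375457798776923)) ^ 2 +
  C (200095986598526927655540494297251877430745/14320348094599593611858304468785947569152) * (qA (0) (0) (0) (0) (0) (1) (-236233544944708157341148041435775493209144/200095986598526927655540494297251877430745) (-2812981618599502474739584322063537702990019752699/15531618240252824329599199572503109542148464836608) (132064024433098578365360063398548142390596/200095986598526927655540494297251877430745) (-895306023230426143416588122965754059289689/1800863879386742348899864448675266896876705) (-212521971365297443485932063744807670834869/200095986598526927655540494297251877430745) (6418867055969644433853244247769670183542482639/4840722107791563433842835638039117418804583040)) ^ 2 +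
  C (512155743650944370394498279364318464663962355094673/465948547207584729887975987175093286264453945098240) * (qA (0) (0) (0) (0) (0) (0) (1) (12359349571943544803308996906890786318453341933992689/65555935187320879410495779758632763476987181452118144) (-160702404714500021507284141831188728568782507972736/512155743650944370394498279364318464663962355094673) (-18455267759981454118644967437911158875589234930924717/16388983796830219852623944939658190869246795363029536) (990135599005129853149737499799510047440154795425024/512155743650944370394498279364318464663962355094673) (-908627536337374479292384496917989301176412562303152/512155743650944370394498279364318464663962355094673)) ^ 2 +
  C (1408574691865316883958657946803043077997178346268115042212860556891161373/1974870762403348182247262037787794217574730205759370969410914686808883200) * (qA (0) (0) (0) (0) (0) (0) (0) (1) (-7386092512340964134546079702368898544780665024879779397068708364327321600/1408574691865316883958657946803043077997178346268115042212860556891161373) (-1116603626802916024496642676405396926771178720944995400624116307953336320/1408574691865316883958657946803043077997178346268115042212860556891161373) (15700776842554426679674888234908571187462463955087981272302557650830622720/1408574691865316883958657946803043077997178346268115042212860556891161373) (-27064265670973325425850598277943392164321960281713972948062000895658961920/4225724075595950651875973840409129233991535038804345126638581670673484119)) ^ 2 +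
  C (1621506337306756006575221376730846646034531059253880603631184917070147761374289/778885461613845624153779498264210700409319738352416893742023373538536592814080) * (qA (0) (0) (0) (0) (0) (0) (0) (0) (1) (-23162723612238982008925699200840931891439461025329798478460692792355045148940843763/46491829703259308220524747313626835035102074530927264667313333942235276614123614208) (-1139108953075094272217775263943562005162650214103886619509351001488825801467479975/726434839113426690945699176775419297423469914545738510426770842847426197095681472) (52464805854535330384457231873823487499654626133470950757242803940867017175547969/45402177444589168184106198548463706088966869659108656901673177677964137318480092)) ^ 2 +
  C (76256928260573080604314385622056047329327100374863807196246232402325303465746301731492750846349/34643854083043302880138972554545881729565917964830665723797357338516601672104206874205875077120) * (qA (0) (0) (0) (0) (0) (0) (0) (0) (0) (1) (-215441770030501620361549926192944526197314045325055561819892693958719722315651750057890041137600/76256928260573080604314385622056047329327100374863807196246232402325303465746301731492750846349) (1335095148474217125757403302702483287401225562246158988016995679086367778971912060469561762784256/686312354345157725438829470598504425963943903373774264766216091620927731191716715583434757617141)) ^ 2 +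
  C (42049478376943844815584295253226212528963425679991255462377487209543240570137442680377120890849066347/174915091766972109366952165164447279122117329755847606394461758035157688077590237059628812181321482240) * (qA (0) (0) (0) (0) (0) (0) (0) (0) (0) (0) (1) (-4119612816474921568341810510432817327928794163163436577296984768029760422916861234959012846967673075006/3406007748532451430062327915511323214846037480079291692452576463973002486181132857110546792158774374107)) ^ 2 +
  C (110358324687610521853023900634338556743841215608256418292821942432312254217332683261378275362591087846249836269/70875583631459875427017710615472068832651760151742165692418757678904623065480121862700454212157704717366371287040) * (qA (0) (0) (0) (0) (0) (0) (0) (0) (0) (0) (0) (1)) ^ 2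

lemma sos_sigA : SOSd 4 (sigA) :=
  (SOSd.add (SOSd.add (SOSd.add (SOSd.add (SOSd.add (SOSd.add (SOSd.add (SOSd.add (SOSd.add (SOSd.add (SOSd.add (SOSd.smul _ (by norm_num) (SOSd.sq (deg_qA _ _ _ _ _ _ _ _ _ _ _ _)))
    (SOSd.smul _ (by norm_num) (SOSd.sq (deg_qA _ _ _ _ _ _ _ _ _ _ _ _))))
    (SOSd.smul _ (by norm_num) (SOSd.sq (deg_qA _ _ _ _ _ _ _ _ _ _ _ _))))
    (SOSd.smul _ (by norm_num) (SOSd.sq (deg_qA _ _ _ _ _ _ _ _ _ _ _ _))))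
    (SOSd.smul _ (by norm_num) (SOSd.sq (deg_qA _ _ _ _ _ _ _ _ _ _ _ _))))
    (SOSd.smul _ (by norm_num) (SOSd.sq (deg_qA _ _ _ _ _ _ _ _ _ _ _ _))))
    (SOSd.smul _ (by norm_num) (SOSd.sq (deg_qA _ _ _ _ _ _ _ _ _ _ _ _))))
    (SOSd.smul _ (by norm_num) (SOSd.sq (deg_qA _ _ _ _ _ _ _ _ _ _ _ _))))
    (SOSd.smul _ (by norm_num) (SOSd.sq (deg_qA _ _ _ _ _ _ _ _ _ _ _ _))))
    (SOSd.smul _ (by norm_num) (SOSd.sq (deg_qA _ _ _ _ _ _ _ _ _ _ _ _))))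
    (SOSd.smul _ (by norm_num) (SOSd.sq (deg_qA _ _ _ _ _ _ _ _ _ _ _ _))))
    (SOSd.smul _ (by norm_num) (SOSd.sq (deg_qA _ _ _ _ _ _ _ _ _ _ _ _))))

noncomputable def sigB (i : Fin 8) : MvPolynomial (Fin 8) ℝ :=
  C (271/1024) * (qB (1) (-75207/8672) (168/271) (-399/271) (5553/271) (224/271) (-250/271) (547/271) (-694/271) (-3166/271) (-179/271) (-507/271) (482/271) (-31/271) i) ^ 2 +
  C (2107359055/284164096) * (qB (0) (1) (-465167904/2107359055) (1510930144/2107359055) (-9216517408/2107359055) (2570135552/2107359055) (-427660992/2107359055) (-1263253856/2107359055) (445413824/421471811) (5011777984/2107359055) (-553442464/2107359055) (-715378592/2107359055) (-668481088/2107359055) (151603976145197/998382425896800) i) ^ 2 +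
  C (1483251819191/2157935672320) * (qB (0) (0) (1) (-5761119913336/1483251819191) (8689601390432/1483251819191) (-8670730086908/1483251819191) (153604657216102657705/164473213948472328192) (-88360767651/1483251819191) (14769860748115/1483251819191) (-22040436741766/1483251819191) (-2000427313079/1483251819191) (14490767748618/1483251819191) (-2854490179538/1483251819191) (-206246641899251289061/5756562488196531486720) i) ^ 2 +
  C (22758080316360099/1518849862851584) * (qB (0) (0) (0) (1) (-20455217289165541/22758080316360099) (-51310512091209907/364129285061761584) (-7385195657989714513032871/88325063726520406034350080) (-1883072264500031/7586026772120033) (-476532700050715865496221/234907084379043633070080) (60910766121333493/22758080316360099) (13340869055247893/22758080316360099) (-25213726621390879/22758080316360099) (192612236845342/385730174853561) (-47321469955162764101713/525744426943573845442560) i) ^ 2 +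
  C (290232860460468568825/23304274243952741376) * (qB (0) (0) (0) (0) (1) (-3797108052324289585289/4643725767367497101200) (29105548007155491082849222703/225281179601717803690446028800) (-179631728280610454577/290232860460468568825) (6837689169906225673448591849/2995760367044119729926144000) (-21182718252247426666/5923119601234052425) (-1579231081485099566661/365782706598793617817600) (579581128630015721143/290232860460468568825) (-170564394987119677188041081/230443105157239979225088000) (245258009046711196032674251/2406850209420062005239808000) i) ^ 2 +
  C (42997083536788160443490587/9510350371568634063257600) * (qB (0) (0) (0) (0) (0) (1) (-735657153718367982164748090499319/2085918545550208910510909490905088) (36294047943266488730358356/42997083536788160443490587) (-26665555779059043482101379089039/9246092843750926021768215828480) (98416283215898675409973402/42997083536788160443490587) (398873476577953276720099094231/1056696325000105831059224666112) (-100817603887499826524394104/42997083536788160443490587) (784630396726442803854985771804051/665718684750066673567311539650560) (-4456806129471097528453371640862513/20859185455502089105109094909050880) i) ^ 2 +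
  C (108646228958028065522425197511090151045516378917/663186417007475936989214175357215151660151603200) * (qB (0) (0) (0) (0) (0) (0) (1) (-49903004907999906016363843483785329569978122240/108646228958028065522425197511090151045516378917) (630710552373017455294560762946882198210806399744/108646228958028065522425197511090151045516378917) (-844931905224918423394438460321171447980008407040/108646228958028065522425197511090151045516378917) (-406619224143287176758938022363917537314591457760/108646228958028065522425197511090151045516378917) (893909635719004020107002613136110124646025134080/108646228958028065522425197511090151045516378917) (-1357154107020593354050027267860264139705846538032/325938686874084196567275592533270453136549136751) (70427281910648859746877517008559044300467657853/108646228958028065522425197511090151045516378917) i) ^ 2 +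
  C (8529450425294567441904145365244461794576023643890645/2002567292154373303709341240524413664070957896198144) * (qB (0) (0) (0) (0) (0) (0) (0) (1) (-470123172818388001018291439293780210835170499708871341391/174683144710032741210196897080206577552916964226880409600) (27669702011961975712290838985126326908393946144582593/17058900850589134883808290730488923589152047287781290) (-118851352518406838797070831363029369878822765644434137459/279493031536052385936315035328330524084667142763008655360) (87809743724948227431807899483327584864243729491360970547/152847751621278648558922284945180755358802343698520358400) (3853776838958512319548431011258716177748261022118261919051/58693536622571001046626157418949410057780099980231817625600) (-36183929966366786962586563468195177359904242791202706002309/1839064147507224699460952932460414848477109799380596952268800) i) ^ 2 +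
  C (17483811502077929596524780159658920699628868717308356971337859172669/1038565696346139543639756800204232505137602690722207547976056832000) * (qB (0) (0) (0) (0) (0) (0) (0) (0) (1) (-25977268252060946205293474275015714959798670532850973521424233799680/17483811502077929596524780159658920699628868717308356971337859172669) (-61904293160982491319589099576581942640210155851498542795763553354195/139870492016623436772198241277271365597030949738466855770702873381352) (19289258635973222331263922357719443106502412581800164002785775667458/17483811502077929596524780159658920699628868717308356971337859172669) (-277813545697740728359128562072699005132874367487575920953633529845287/839222952099740620633189447663628193582185698430801134624217240288112) (121965445512144335696218962548518370785794461225798043508198374359821/2022742499932708162551789950779001287095524503910136068068626168899552) i) ^ 2 +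
  C (55014040980388371857277981688084923355716857672287487906473126837421207/35806845956255599813682749766981469592839923133047515077299935585626112) * (qB (0) (0) (0) (0) (0) (0) (0) (0) (0) (1) (-133916842141296021825202523599151988363023468892190867126350055681836696599/676012535567012313382231838983187538195048747077068651394741782578231791616) (-7584171924493454295977341629236833349984354582697838862322152388602252543161/5915109686211357742094528591102890959206676536924350699703990597559528176640) (220348765249243618018305455566097567808114416913612373406920188074592381188141/425887897407217757430806058559408149062880710658553250378687323024286028718080) (15275418012624276817929064387586226281011222135553151281285951814246471833177/13344487452092823066165256501528122003970262267301335178532202788094295566499840) i) ^ 2 +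
  C (18315502397318811364315231671693583936442122202464920573611093817727341858289115643/7561072218610298704182262749798771797871055306827566274185522767026687777339080704) * (qB (0) (0) (0) (0) (0) (0) (0) (0) (0) (0) (1) (-7680259037626538116383675791214364175825270008123898222715467225408813841266034962992/5769383255155425579759297976583478939979268493776449980687494552584112685361071427545) (14733202093381716645902267660429154619981733053581056844724499025832747370856603670357/34616299530932553478555787859500873639875610962658699884124967315504676112166428565270) (-607190329197702971705706108807124992006524536519185806682254165432893570944194341387693/3253932155907660026984244058793082122148307430489917789107746927657439554543644285135380) i) ^ 2 +
  C (791679763194115666206256033019959927537279490839159958356413232770018987969198014085217441348669/390274170283975576126941383691183999812572355305675257182013776017548931296671500792006484951040) * (qB (0) (0) (0) (0) (0) (0) (0) (0) (0) (0) (0) (1) (-2135771970442304878518493137431024269515611098564880855241149986892677344598737162554467412069120/2375039289582346998618768099059879782611838472517479875069239698310056963907594042255652324046007) (99713232190373398443004311679434443124182905555571986333657236966269939736081709541945282646565118/558134233051851544675410503279071748913782041041607770641271329102863386518284599930078296150811645) i) ^ 2 +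
  C (41992441850207914796244685149707755527738195568828928772203828068199444685049306167341836650631652852333/143003965672900611603234369766114233566797928636444484253769005322886501865232926397063533213598936678400) * (qB (0) (0) (0) (0) (0) (0) (0) (0) (0) (0) (0) (0) (1) (-8555966758262260259659443756615584158919177529116099713794170222453031418539703965449540232754456156312637405/16168097930934452186509313655081078864311871010692789471589006698130422990416424057774623314572801507816660992) i) ^ 2 +
  C (10920018013929856258220286305430196693385233901869090762128735658934649138686102787230837113395496275005420545385517049259/2409564128126279950390206903006646581934861952491448992549308825853630358520495360949240895848949358477145689000222130176000) * (qB (0) (0) (0) (0) (0) (0) (0) (0) (0) (0) (0) (0) (0) (1) i) ^ 2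

lemma sos_sigB (i : Fin 8) : SOSd 3 (sigB i) :=
  (SOSd.add (SOSd.add (SOSd.add (SOSd.add (SOSd.add (SOSd.add (SOSd.add (SOSd.add (SOSd.add (SOSd.add (SOSd.add (SOSd.add (SOSd.add (SOSd.smul _ (by norm_num) (SOSd.sq (deg_qB _ _ _ _ _ _ _ _ _ _ _ _ _ _ i)))
    (SOSd.smul _ (by norm_num) (SOSd.sq (deg_qB _ _ _ _ _ _ _ _ _ _ _ _ _ _ i))))
    (SOSd.smul _ (by norm_num) (SOSd.sq (deg_qB _ _ _ _ _ _ _ _ _ _ _ _ _ _ i))))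
    (SOSd.smul _ (by norm_num) (SOSd.sq (deg_qB _ _ _ _ _ _ _ _ _ _ _ _ _ _ i))))
    (SOSd.smul _ (by norm_num) (SOSd.sq (deg_qB _ _ _ _ _ _ _ _ _ _ _ _ _ _ i))))
    (SOSd.smul _ (by norm_num) (SOSd.sq (deg_qB _ _ _ _ _ _ _ _ _ _ _ _ _ _ i))))
    (SOSd.smul _ (by norm_num) (SOSd.sq (deg_qB _ _ _ _ _ _ _ _ _ _ _ _ _ _ i))))
    (SOSd.smul _ (by norm_num) (SOSd.sq (deg_qB _ _ _ _ _ _ _ _ _ _ _ _ _ _ i))))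
    (SOSd.smul _ (by norm_num) (SOSd.sq (deg_qB _ _ _ _ _ _ _ _ _ _ _ _ _ _ i))))
    (SOSd.smul _ (by norm_num) (SOSd.sq (deg_qB _ _ _ _ _ _ _ _ _ _ _ _ _ _ i))))
    (SOSd.smul _ (by norm_num) (SOSd.sq (deg_qB _ _ _ _ _ _ _ _ _ _ _ _ _ _ i))))
    (SOSd.smul _ (by norm_num) (SOSd.sq (deg_qB _ _ _ _ _ _ _ _ _ _ _ _ _ _ i))))
    (SOSd.smul _ (by norm_num) (SOSd.sq (deg_qB _ _ _ _ _ _ _ _ _ _ _ _ _ _ i))))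
    (SOSd.smul _ (by norm_num) (SOSd.sq (deg_qB _ _ _ _ _ _ _ _ _ _ _ _ _ _ i))))

noncomputable def sigC : MvPolynomial (Fin 8) ℝ :=
  C (849975/1048576) * (C (1/1680) * L2 X Finset.univ (qC (1) (-29668/8095) (177152/56665))) +
  C (8731359751897/61278177460224) * (C (1/1680) * L2 X Finset.univ (qC (0) (1) (-37709510308978/26194079255691))) +
  C (1532895447872861323997/110744858849649478336512) * (C (1/1680) * L2 X Finset.univ (qC (0) (0) (1)))

lemma sos_sigC : SOSd 4 (sigC) :=
  (SOSd.add (SOSd.add (SOSd.smul _ (by norm_num) (SOSd.smul _ (by norm_num) (sos_L2 _ _ 2 (deg_qC _ _ _))))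
    (SOSd.smul _ (by norm_num) (SOSd.smul _ (by norm_num) (sos_L2 _ _ 2 (deg_qC _ _ _)))))
    (SOSd.smul _ (by norm_num) (SOSd.smul _ (by norm_num) (sos_L2 _ _ 2 (deg_qC _ _ _)))))

noncomputable def sigD : MvPolynomial (Fin 8) ℝ :=
  C (166067570339/605590388736) * (C (1/20160) * L3 X Finset.univ (qD (1) (-374718603139/166067570339))) +
  C (80254823198751632185/2139764350596553900032) * (C (1/20160) * L3 X Finset.univ (qD (0) (1)))

lemma sos_sigD : SOSd 4 (sigD) :=
  (SOSd.add (SOSd.smul _ (by norm_num) (SOSd.smul _ (by norm_num) (sos_L3 _ _ 1 (deg_qD _ _))))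
    (SOSd.smul _ (by norm_num) (SOSd.smul _ (by norm_num) (sos_L3 _ _ 1 (deg_qD _ _)))))

noncomputable def reA (m1 m2 m3 m4 m5 m6 m7 m8 : ℝ) : ℝ :=
  (1/80) * (rA (1) (-1355/128) (-325/128) (81875/2048) (-855/64) (4415/64) (-7415/64) (-16539168419/7096762368) (2575/64) (125/16) (-10665/64) (10265/64) m1 m2 m3 m4) ^ 2 +
  (574107/262144) * (rA (0) (1) (-68875/574107) (-51777443/9185712) (-225382/191369) (1004918/191369) (3206158/574107) (-106261482514541/371355555594240) (2075074/574107) (181912/574107) (-2318746/191369) (713978/191369) m1 m2 m3 m4) ^ 2 +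
  (79819264553/37624676352) * (rA (0) (0) (1) (-102778511840/79819264553) (-167138092074266133/537815819016949760) (-278297966592/79819264553) (391901704192/79819264553) (-2678261211514235/13445395475423744) (111810553024/79819264553) (21172444809156787/403361864262712320) (916968960/609307363) (-299841228096/79819264553) m1 m2 m3 m4) ^ 2 +
  (104452976187101909/20924141286981632) * (rA (0) (0) (0) (1) (-193190788712489967661/1099680933297808897952) (-737273996981776/104452976187101909) (-266429760411504944/104452976187101909) (2283952739357917371312293/12668324351590758504407040) (-78778096545321472/104452976187101909) (-860877016242050863343/2474282099920070020392) (296163332622081040/104452976187101909) (-19382213268521856/104452976187101909) m1 m2 m3 m4) ^ 2 +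
  (13984714936132415636580375457798776923/8391048168905480949794172071785267200) * (rA (0) (0) (0) (0) (1) (-39631331144168668133679512480655605760/13984714936132415636580375457798776923) (26957947230093780864892103406905425920/13984714936132415636580375457798776923) (-87919395897306942936691088291241240/208727088598991278157916051608936969) (-4537719847765396986283005044562411520/13984714936132415636580375457798776923) (-11154092663578775209125977918704842876/13984714936132415636580375457798776923) (80537280090564999054629702544968908800/13984714936132415636580375457798776923) (-63218677066795791123771745340475310080/13984714936132415636580375457798776923) m1 m2 m3 m4) ^ 2 +
  (200095986598526927655540494297251877430745/14320348094599593611858304468785947569152) * (rA (0) (0) (0) (0) (0) (1) (-236233544944708157341148041435775493209144/200095986598526927655540494297251877430745) (-2812981618599502474739584322063537702990019752699/15531618240252824329599199572503109542148464836608) (132064024433098578365360063398548142390596/200095986598526927655540494297251877430745) (-895306023230426143416588122965754059289689/1800863879386742348899864448675266896876705) (-212521971365297443485932063744807670834869/200095986598526927655540494297251877430745) (6418867055969644433853244247769670183542482639/4840722107791563433842835638039117418804583040) m1 m2 m3 m4) ^ 2 +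
  (512155743650944370394498279364318464663962355094673/465948547207584729887975987175093286264453945098240) * (rA (0) (0) (0) (0) (0) (0) (1) (12359349571943544803308996906890786318453341933992689/65555935187320879410495779758632763476987181452118144) (-160702404714500021507284141831188728568782507972736/512155743650944370394498279364318464663962355094673) (-18455267759981454118644967437911158875589234930924717/16388983796830219852623944939658190869246795363029536) (990135599005129853149737499799510047440154795425024/512155743650944370394498279364318464663962355094673) (-908627536337374479292384496917989301176412562303152/512155743650944370394498279364318464663962355094673) m1 m2 m3 m4) ^ 2 +
  (1408574691865316883958657946803043077997178346268115042212860556891161373/1974870762403348182247262037787794217574730205759370969410914686808883200) * (rA (0) (0) (0) (0) (0) (0) (0) (1) (-7386092512340964134546079702368898544780665024879779397068708364327321600/1408574691865316883958657946803043077997178346268115042212860556891161373) (-1116603626802916024496642676405396926771178720944995400624116307953336320/1408574691865316883958657946803043077997178346268115042212860556891161373) (15700776842554426679674888234908571187462463955087981272302557650830622720/1408574691865316883958657946803043077997178346268115042212860556891161373) (-27064265670973325425850598277943392164321960281713972948062000895658961920/4225724075595950651875973840409129233991535038804345126638581670673484119) m1 m2 m3 m4) ^ 2 +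
  (1621506337306756006575221376730846646034531059253880603631184917070147761374289/778885461613845624153779498264210700409319738352416893742023373538536592814080) * (rA (0) (0) (0) (0) (0) (0) (0) (0) (1) (-23162723612238982008925699200840931891439461025329798478460692792355045148940843763/46491829703259308220524747313626835035102074530927264667313333942235276614123614208) (-1139108953075094272217775263943562005162650214103886619509351001488825801467479975/726434839113426690945699176775419297423469914545738510426770842847426197095681472) (52464805854535330384457231873823487499654626133470950757242803940867017175547969/45402177444589168184106198548463706088966869659108656901673177677964137318480092) m1 m2 m3 m4) ^ 2 +
  (76256928260573080604314385622056047329327100374863807196246232402325303465746301731492750846349/34643854083043302880138972554545881729565917964830665723797357338516601672104206874205875077120) * (rA (0) (0) (0) (0) (0) (0) (0) (0) (0) (1) (-215441770030501620361549926192944526197314045325055561819892693958719722315651750057890041137600/76256928260573080604314385622056047329327100374863807196246232402325303465746301731492750846349) (1335095148474217125757403302702483287401225562246158988016995679086367778971912060469561762784256/686312354345157725438829470598504425963943903373774264766216091620927731191716715583434757617141) m1 m2 m3 m4) ^ 2 +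
  (42049478376943844815584295253226212528963425679991255462377487209543240570137442680377120890849066347/174915091766972109366952165164447279122117329755847606394461758035157688077590237059628812181321482240) * (rA (0) (0) (0) (0) (0) (0) (0) (0) (0) (0) (1) (-4119612816474921568341810510432817327928794163163436577296984768029760422916861234959012846967673075006/3406007748532451430062327915511323214846037480079291692452576463973002486181132857110546792158774374107) m1 m2 m3 m4) ^ 2 +
  (110358324687610521853023900634338556743841215608256418292821942432312254217332683261378275362591087846249836269/70875583631459875427017710615472068832651760151742165692418757678904623065480121862700454212157704717366371287040) * (rA (0) (0) (0) (0) (0) (0) (0) (0) (0) (0) (0) (1) m1 m2 m3 m4) ^ 2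

noncomputable def reB (m1 m2 m3 m4 m5 m6 m7 m8 : ℝ) : ℝ :=
  (271/1024) * rB (1) (-75207/8672) (168/271) (-399/271) (5553/271) (224/271) (-250/271) (547/271) (-694/271) (-3166/271) (-179/271) (-507/271) (482/271) (-31/271) m1 m2 m3 m4 m5 m6 m7 m8 +
  (2107359055/284164096) * rB (0) (1) (-465167904/2107359055) (1510930144/2107359055) (-9216517408/2107359055) (2570135552/2107359055) (-427660992/2107359055) (-1263253856/2107359055) (445413824/421471811) (5011777984/2107359055) (-553442464/2107359055) (-715378592/2107359055) (-668481088/2107359055) (151603976145197/998382425896800) m1 m2 m3 m4 m5 m6 m7 m8 +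
  (1483251819191/2157935672320) * rB (0) (0) (1) (-5761119913336/1483251819191) (8689601390432/1483251819191) (-8670730086908/1483251819191) (153604657216102657705/164473213948472328192) (-88360767651/1483251819191) (14769860748115/1483251819191) (-22040436741766/1483251819191) (-2000427313079/1483251819191) (14490767748618/1483251819191) (-2854490179538/1483251819191) (-206246641899251289061/5756562488196531486720) m1 m2 m3 m4 m5 m6 m7 m8 +
  (22758080316360099/1518849862851584) * rB (0) (0) (0) (1) (-20455217289165541/22758080316360099) (-51310512091209907/364129285061761584) (-7385195657989714513032871/88325063726520406034350080) (-1883072264500031/7586026772120033) (-476532700050715865496221/234907084379043633070080) (60910766121333493/22758080316360099) (13340869055247893/22758080316360099) (-25213726621390879/22758080316360099) (192612236845342/385730174853561) (-47321469955162764101713/525744426943573845442560) m1 m2 m3 m4 m5 m6 m7 m8 +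
  (290232860460468568825/23304274243952741376) * rB (0) (0) (0) (0) (1) (-3797108052324289585289/4643725767367497101200) (29105548007155491082849222703/225281179601717803690446028800) (-179631728280610454577/290232860460468568825) (6837689169906225673448591849/2995760367044119729926144000) (-21182718252247426666/5923119601234052425) (-1579231081485099566661/365782706598793617817600) (579581128630015721143/290232860460468568825) (-170564394987119677188041081/230443105157239979225088000) (245258009046711196032674251/2406850209420062005239808000) m1 m2 m3 m4 m5 m6 m7 m8 +
  (42997083536788160443490587/9510350371568634063257600) * rB (0) (0) (0) (0) (0) (1) (-735657153718367982164748090499319/2085918545550208910510909490905088) (36294047943266488730358356/42997083536788160443490587) (-26665555779059043482101379089039/9246092843750926021768215828480) (98416283215898675409973402/42997083536788160443490587) (398873476577953276720099094231/1056696325000105831059224666112) (-100817603887499826524394104/42997083536788160443490587) (784630396726442803854985771804051/665718684750066673567311539650560) (-4456806129471097528453371640862513/20859185455502089105109094909050880) m1 m2 m3 m4 m5 m6 m7 m8 +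
  (108646228958028065522425197511090151045516378917/663186417007475936989214175357215151660151603200) * rB (0) (0) (0) (0) (0) (0) (1) (-49903004907999906016363843483785329569978122240/108646228958028065522425197511090151045516378917) (630710552373017455294560762946882198210806399744/108646228958028065522425197511090151045516378917) (-844931905224918423394438460321171447980008407040/108646228958028065522425197511090151045516378917) (-406619224143287176758938022363917537314591457760/108646228958028065522425197511090151045516378917) (893909635719004020107002613136110124646025134080/108646228958028065522425197511090151045516378917) (-1357154107020593354050027267860264139705846538032/325938686874084196567275592533270453136549136751) (70427281910648859746877517008559044300467657853/108646228958028065522425197511090151045516378917) m1 m2 m3 m4 m5 m6 m7 m8 +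
  (8529450425294567441904145365244461794576023643890645/2002567292154373303709341240524413664070957896198144) * rB (0) (0) (0) (0) (0) (0) (0) (1) (-470123172818388001018291439293780210835170499708871341391/174683144710032741210196897080206577552916964226880409600) (27669702011961975712290838985126326908393946144582593/17058900850589134883808290730488923589152047287781290) (-118851352518406838797070831363029369878822765644434137459/279493031536052385936315035328330524084667142763008655360) (87809743724948227431807899483327584864243729491360970547/152847751621278648558922284945180755358802343698520358400) (3853776838958512319548431011258716177748261022118261919051/58693536622571001046626157418949410057780099980231817625600) (-36183929966366786962586563468195177359904242791202706002309/1839064147507224699460952932460414848477109799380596952268800) m1 m2 m3 m4 m5 m6 m7 m8 +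
  (17483811502077929596524780159658920699628868717308356971337859172669/1038565696346139543639756800204232505137602690722207547976056832000) * rB (0) (0) (0) (0) (0) (0) (0) (0) (1) (-25977268252060946205293474275015714959798670532850973521424233799680/17483811502077929596524780159658920699628868717308356971337859172669) (-61904293160982491319589099576581942640210155851498542795763553354195/139870492016623436772198241277271365597030949738466855770702873381352) (19289258635973222331263922357719443106502412581800164002785775667458/17483811502077929596524780159658920699628868717308356971337859172669) (-277813545697740728359128562072699005132874367487575920953633529845287/839222952099740620633189447663628193582185698430801134624217240288112) (121965445512144335696218962548518370785794461225798043508198374359821/2022742499932708162551789950779001287095524503910136068068626168899552) m1 m2 m3 m4 m5 m6 m7 m8 +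
  (55014040980388371857277981688084923355716857672287487906473126837421207/35806845956255599813682749766981469592839923133047515077299935585626112) * rB (0) (0) (0) (0) (0) (0) (0) (0) (0) (1) (-133916842141296021825202523599151988363023468892190867126350055681836696599/676012535567012313382231838983187538195048747077068651394741782578231791616) (-7584171924493454295977341629236833349984354582697838862322152388602252543161/5915109686211357742094528591102890959206676536924350699703990597559528176640) (220348765249243618018305455566097567808114416913612373406920188074592381188141/425887897407217757430806058559408149062880710658553250378687323024286028718080) (15275418012624276817929064387586226281011222135553151281285951814246471833177/13344487452092823066165256501528122003970262267301335178532202788094295566499840) m1 m2 m3 m4 m5 m6 m7 m8 +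
  (18315502397318811364315231671693583936442122202464920573611093817727341858289115643/7561072218610298704182262749798771797871055306827566274185522767026687777339080704) * rB (0) (0) (0) (0) (0) (0) (0) (0) (0) (0) (1) (-7680259037626538116383675791214364175825270008123898222715467225408813841266034962992/5769383255155425579759297976583478939979268493776449980687494552584112685361071427545) (14733202093381716645902267660429154619981733053581056844724499025832747370856603670357/34616299530932553478555787859500873639875610962658699884124967315504676112166428565270) (-607190329197702971705706108807124992006524536519185806682254165432893570944194341387693/3253932155907660026984244058793082122148307430489917789107746927657439554543644285135380) m1 m2 m3 m4 m5 m6 m7 m8 +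
  (791679763194115666206256033019959927537279490839159958356413232770018987969198014085217441348669/390274170283975576126941383691183999812572355305675257182013776017548931296671500792006484951040) * rB (0) (0) (0) (0) (0) (0) (0) (0) (0) (0) (0) (1) (-2135771970442304878518493137431024269515611098564880855241149986892677344598737162554467412069120/2375039289582346998618768099059879782611838472517479875069239698310056963907594042255652324046007) (99713232190373398443004311679434443124182905555571986333657236966269939736081709541945282646565118/558134233051851544675410503279071748913782041041607770641271329102863386518284599930078296150811645) m1 m2 m3 m4 m5 m6 m7 m8 +
  (41992441850207914796244685149707755527738195568828928772203828068199444685049306167341836650631652852333/143003965672900611603234369766114233566797928636444484253769005322886501865232926397063533213598936678400) * rB (0) (0) (0) (0) (0) (0) (0) (0) (0) (0) (0) (0) (1) (-8555966758262260259659443756615584158919177529116099713794170222453031418539703965449540232754456156312637405/16168097930934452186509313655081078864311871010692789471589006698130422990416424057774623314572801507816660992) m1 m2 m3 m4 m5 m6 m7 m8 +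
  (10920018013929856258220286305430196693385233901869090762128735658934649138686102787230837113395496275005420545385517049259/2409564128126279950390206903006646581934861952491448992549308825853630358520495360949240895848949358477145689000222130176000) * rB (0) (0) (0) (0) (0) (0) (0) (0) (0) (0) (0) (0) (0) (1) m1 m2 m3 m4 m5 m6 m7 m8

noncomputable def reC (m1 m2 m3 m4 m5 m6 m7 m8 : ℝ) : ℝ :=
  (849975/1048576) * (1/1680 * ((rC (1) (-29668/8095) (177152/56665) m1 m2 m3 m4) ^ 2 * polyL2 8 (8*m1) (8*m2) (8*m3) (8*m4) (8*m5) (8*m6))) +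
  (8731359751897/61278177460224) * (1/1680 * ((rC (0) (1) (-37709510308978/26194079255691) m1 m2 m3 m4) ^ 2 * polyL2 8 (8*m1) (8*m2) (8*m3) (8*m4) (8*m5) (8*m6))) +
  (1532895447872861323997/110744858849649478336512) * (1/1680 * ((rC (0) (0) (1) m1 m2 m3 m4) ^ 2 * polyL2 8 (8*m1) (8*m2) (8*m3) (8*m4) (8*m5) (8*m6)))

noncomputable def reD (m1 m2 m3 m4 m5 m6 m7 m8 : ℝ) : ℝ :=
  (166067570339/605590388736) * (1/20160 * ((rD (1) (-374718603139/166067570339) m1 m2 m3 m4) ^ 2 * polyL3 8 (8*m1) (8*m2) (8*m3) (8*m4) (8*m5) (8*m6))) +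
  (80254823198751632185/2139764350596553900032) * (1/20160 * ((rD (0) (1) m1 m2 m3 m4) ^ 2 * polyL3 8 (8*m1) (8*m2) (8*m3) (8*m4) (8*m5) (8*m6)))

lemma eval_sigA (x : Fin 8 → ℝ) : eval x sigA = reA (pm x 1) (pm x 2) (pm x 3) (pm x 4) (pm x 5) (pm x 6) (pm x 7) (pm x 8) := by
  simp only [sigA, reA, map_add, map_mul, map_pow, eval_C, eval_qA]

lemma eval_sigC (x : Fin 8 → ℝ) : eval x sigC = reC (pm x 1) (pm x 2) (pm x 3) (pm x 4) (pm x 5) (pm x 6) (pm x 7) (pm x 8) := by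
  simp only [sigC, reC, map_add, map_mul, map_pow, eval_C, eval_qC, eval_L2, L2_eq, qs_univ, pm_zero, mul_one]

lemma eval_sigD (x : Fin 8 → ℝ) : eval x sigD = reD (pm x 1) (pm x 2) (pm x 3) (pm x 4) (pm x 5) (pm x 6) (pm x 7) (pm x 8) := by
  simp only [sigD, reD, map_add, map_mul, map_pow, eval_C, eval_qD, eval_L3, L3_eq, qs_univ, pm_zero, mul_one]

lemma eval_sigB (x : Fin 8 → ℝ) :
    1 / 8 * ∑ i, eval x (sigB i) * (x i - x i ^ 2) = reB (pm x 1) (pm x 2) (pm x 3) (pm x 4) (pm x 5) (pm x 6) (pm x 7) (pm x 8) := by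
  simp only [sigB, reB, map_add, map_mul, map_pow, eval_C, add_mul, Finset.sum_add_distrib, mul_add,
    ← eval_qB, mul_assoc, ← Finset.mul_sum]
  simp only [mul_left_comm (1 / 8 : ℝ)]

noncomputable def e8m (m1 m2 m3 m4 m5 m6 m7 m8 : ℝ) : ℝ :=
  (-1)*m8 + (64/7)*m7*m1 + (16/3)*m6*m2 + (-128/3)*m6*m1*m1 + (64/15)*m5*m3 + (-256/5)*m5*m2*m1 + (2048/15)*m5*m1*m1*m1 + (2)*m4*m4 + (-128/3)*m4*m3*m1 + (-16)*m4*m2*m2 + (256)*m4*m2*m1*m1 + (-1024/3)*m4*m1*m1*m1*m1 + (-128/9)*m3*m3*m2 + (1024/9)*m3*m3*m1*m1 + (512/3)*m3*m2*m2*m1 + (-8192/9)*m3*m2*m1*m1*m1 + (32768/45)*m3*m1*m1*m1*m1*m1 + (32/3)*m2*m2*m2*m2 + (-1024/3)*m2*m2*m2*m1*m1 + (4096/3)*m2*m2*m1*m1*m1*m1 + (-65536/45)*m2*m1*m1*m1*m1*m1*m1 + (131072/315)*m1*m1*m1*m1*m1*m1*m1*m1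

lemma prod_e8m (x : Fin 8 → ℝ) : ∏ i, x i = e8m (pm x 1) (pm x 2) (pm x 3) (pm x 4) (pm x 5) (pm x 6) (pm x 7) (pm x 8) := by
  obtain ⟨e1, e2, e3, e4, e5, e6, e7, h1, h2, h3, h4, h5, h6, h7, h8⟩ := prod_eq x
  generalize pm x 1 = m1 at *
  generalize pm x 2 = m2 at *
  generalize pm x 3 = m3 at *
  generalize pm x 4 = m4 at *
  generalize pm x 5 = m5 at *
  generalize pm x 6 = m6 at *
  generalize pm x 7 = m7 at *
  generalize pm x 8 = m8 at *
  subst h1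
  have g2 : e2 = 8 / 2 * (0 + (8*m1) * m1 - m2) := by linear_combination h2 / 2
  have g3 : e3 = 8 / 3 * (0 + e2 * m1 - (8*m1) * m2 + m3) := by linear_combination h3 / 3
  have g4 : e4 = 8 / 4 * (0 + e3 * m1 - e2 * m2 + (8*m1) * m3 - m4) := by linear_combination h4 / 4
  have g5 : e5 = 8 / 5 * (0 + e4 * m1 - e3 * m2 + e2 * m3 - (8*m1) * m4 + m5) := by linear_combination h5 / 5
  have g6 : e6 = 8 / 6 * (0 + e5 * m1 - e4 * m2 + e3 * m3 - e2 * m4 + (8*m1) * m5 - m6) := by linear_combination h6 / 6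
  have g7 : e7 = 8 / 7 * (0 + e6 * m1 - e5 * m2 + e4 * m3 - e3 * m4 + e2 * m5 - (8*m1) * m6 + m7) := by linear_combination h7 / 7
  clear h2 h3 h4 h5 h6 h7
  subst g7
  subst g6
  subst g5
  subst g4
  subst g3
  subst g2
  rw [e8m]
  linear_combination h8 / 8

lemma reA_eq (m1 m2 m3 m4 m5 m6 m7 m8 : ℝ) : reA m1 m2 m3 m4 m5 m6 m7 m8 =
    (1/80) + (-271/1024)*m1 + (75207/16384)*m1*m1 + (-65/1024)*m2 + (479/256)*m2*m1 + (159179/65536)*m2*m2 + (-19541/512)*m1*m1*m1 + (-571/128)*m2*m1*m1 + (160977/1024)*m1*m1*m1*m1 + (-171/512)*m3 + (-79/128)*m3*m1 + (32742013681/220788162560)*m3*m2 + (42707/2048)*m3*m1*m1 + (21741429495973/2980640194560)*m3*m3 + (-11577/512)*m2*m2*m1 + (-13027/512)*m2*m1*m1*m1 + (-27379/512)*m3*m2*m1 + (12325/64)*m2*m2*m1*m1 + (-170021/512)*m1*m1*m1*m1*m1 + (-12393789311107/248386682880)*m3*m1*m1*m1 + (-36049/512)*m2*m1*m1*m1*m1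 + (5045459193181/11643125760)*m1*m1*m1*m1*m1*m1 + (-16539168419/283870494720)*m4 + (-158115659267/248386682880)*m4*m1 + (-35/64)*m4*m2 + (1893644012507/248386682880)*m4*m1*m1 + (51/64)*m4*m3 + (-1738547255569/198709346304)*m4*m2*m1 + (-2717/512)*m4*m1*m1*m1 + (2)*m4*m4 + (-1068236728651/31708938240)*m3*m3*m1 + (72643/256)*m3*m2*m1*m1 + (-5561/64)*m3*m1*m1*m1*m1 + (-30583/1536)*m4*m3*m1 + (42963/512)*m3*m3*m1*m1 + (-218432346277/496773365760)*m2*m2*m2 + (-3257/512)*m3*m2*m2 + (6989/512)*m2*m2*m2*m1 + (-662664278011/990904320)*m2*m2*m1*m1*m1 + (33/64)*m4*m2*m2 + (9317/768)*m3*m2*m2*m1 + (32/3)*m2*m2*m2*m2 + (8911866013/12386304)*m2*m1*m1*m1*m1*m1 + (1367/32)*m4*m2*m1*m1 + (-20185775153/41287680)*m3*m2*m1*m1*m1 + (-2367359369/27525120)*m2*m2*m2*m1*m1 + (19569895927/20643840)*m2*m2*m1*m1*m1*m1 + (-268049/512)*m1*m1*m1*m1*m1*m1*m1 + (-10965/512)*m4*m1*m1*m1*m1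 + (144771/512)*m3*m1*m1*m1*m1*m1 + (-595593/512)*m2*m1*m1*m1*m1*m1*m1 + (496603/1024)*m1*m1*m1*m1*m1*m1*m1*m1 := by
  simp only [reA, rA]
  ring

lemma reB_eq (m1 m2 m3 m4 m5 m6 m7 m8 : ℝ) : reB m1 m2 m3 m4 m5 m6 m7 m8 =
    (271/1024)*m1 + (65/1024)*m2 + (-75207/16384)*m1*m1 + (-479/256)*m2*m1 + (19541/512)*m1*m1*m1 + (10379/512)*m2*m1*m1 + (171/512)*m3 + (-46553/16384)*m3*m1 + (261984749219/283870494720)*m4 + (-3963/512)*m2*m2 + (504163/8192)*m2*m2*m1 + (-32742013681/220788162560)*m3*m2 + (-7423/1024)*m2*m2*m2 + (-10567/64)*m1*m1*m1*m1 + (-46309/512)*m2*m1*m1*m1 + (2303/512)*m3*m1*m1 + (-1257214075741/5284823040)*m2*m2*m1*m1 + (199689/512)*m1*m1*m1*m1*m1 + (153003/512)*m2*m1*m1*m1*m1 + (-1416101648893/248386682880)*m4*m1 + (7137880738417/248386682880)*m3*m2*m1 + (239142581819/15854469120)*m3*m1*m1*m1 + (-1756096307/503316480)*m4*m1*m1 +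 (3185379274963/662364487680)*m4*m2 + (166067570339/47311749120)*m5*m1 + (-166067570339/283870494720)*m6 + (-23089/3840)*m3*m3 + (3257/512)*m3*m2*m2 + (-454823993791/2642411520)*m3*m2*m1*m1 + (64295/2304)*m3*m3*m1 + (-51/64)*m4*m3 + (-128/9)*m3*m3*m2 + (111233034571/5284823040)*m2*m2*m2*m1 + (534117/1024)*m2*m2*m1*m1*m1 + (-2604478120561/248386682880)*m4*m2*m1 + (40585/256)*m3*m2*m2*m1 + (-302617/1024)*m2*m2*m2*m1*m1 + (-287651/512)*m1*m1*m1*m1*m1*m1 + (-1210418273/1720320)*m2*m1*m1*m1*m1*m1 + (1240590403/82575360)*m3*m1*m1*m1*m1 + (695868999013/15854469120)*m4*m1*m1*m1 + (-281933/512)*m3*m2*m1*m1*m1 + (347143/512)*m2*m2*m1*m1*m1*m1 + (593873/1024)*m1*m1*m1*m1*m1*m1*m1 + (-593873/1024)*m2*m1*m1*m1*m1*m1*m1 + (-1057/64)*m4*m2*m2 + (-7972736237/503316480)*m5*m1*m1 + (6038800009/165150720)*m3*m3*m1*m1 + (1010525153/1720320)*m3*m1*m1*m1*m1*m1 + (8645276751/36700160)*m4*m2*m1*m1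 + (-31320761923/82575360)*m4*m1*m1*m1*m1 + (7972736237/3019898880)*m6*m1 + (-11651/512)*m4*m3*m1 + (-256/5)*m5*m2*m1 + (1218063133/7864320)*m5*m1*m1*m1 + (-719195743/15728640)*m6*m1*m1 + (64/15)*m5*m3 + (16/3)*m6*m2 + (64/7)*m7*m1 + (-1)*m8 := by
  simp only [reB, rB]
  ring

lemma reC_eq (m1 m2 m3 m4 m5 m6 m7 m8 : ℝ) : reC m1 m2 m3 m4 m5 m6 m7 m8 =
    (348085/65536)*m2*m2 + (-56665/65536)*m4 + (-8095/512)*m2*m1*m1 + (56665/16384)*m3*m1 + (8095/1024)*m1*m1*m1*m1 + (-318931/8192)*m2*m2*m1 + (51919/8192)*m4*m1 + (7417/64)*m2*m1*m1*m1 + (-51919/2048)*m3*m1*m1 + (-7417/128)*m1*m1*m1*m1*m1 + (26201301226337/248386682880)*m2*m2*m1*m1 + (-609332586659/35483811840)*m4*m1*m1 + (-609332586659/1940520960)*m2*m1*m1*m1*m1 + (609332586659/8870952960)*m3*m1*m1*m1 + (609332586659/3881041920)*m1*m1*m1*m1*m1*m1 + (-493079634191/3963617280)*m2*m2*m1*m1*m1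 + (11466968237/566231040)*m4*m1*m1*m1 + (11466968237/30965760)*m2*m1*m1*m1*m1*m1 + (-11466968237/141557760)*m3*m1*m1*m1*m1 + (-11466968237/61931520)*m1*m1*m1*m1*m1*m1*m1 + (556740049/10321920)*m2*m2*m1*m1*m1*m1 + (-12947443/1474560)*m4*m1*m1*m1*m1 + (-12947443/80640)*m2*m1*m1*m1*m1*m1*m1 + (12947443/368640)*m3*m1*m1*m1*m1*m1 + (12947443/161280)*m1*m1*m1*m1*m1*m1*m1*m1 := by
  simp only [reC, rC, polyL2]
  ring

lemma reD_eq (m1 m2 m3 m4 m5 m6 m7 m8 : ℝ) : reD m1 m2 m3 m4 m5 m6 m7 m8 =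
    (3819554117797/496773365760)*m2*m2*m2 + (-2823148695763/662364487680)*m4*m2 + (166067570339/283870494720)*m6 + (-166067570339/2759852032)*m2*m2*m1*m1 + (6144500102543/248386682880)*m3*m2*m1 + (2158878414407/165591121920)*m4*m1*m1 + (-166067570339/47311749120)*m5*m1 + (-3819554117797/2980640194560)*m3*m3 + (166067570339/1940520960)*m2*m1*m1*m1*m1 + (-3155283836441/93145006080)*m3*m1*m1*m1 + (-166067570339/5821562880)*m1*m1*m1*m1*m1*m1 + (-183372933451/5284823040)*m2*m2*m2*m1 + (135536516029/7046430720)*m4*m2*m1 + (-7972736237/3019898880)*m6*m1 + (7972736237/29360128)*m2*m2*m1*m1*m1 + (-294991240769/2642411520)*m3*m2*m1*m1 + (-103645571081/1761607680)*m4*m1*m1*m1 + (7972736237/503316480)*m5*m1*m1 + (183372933451/31708938240)*m3*m3*m1 + (-7972736237/20643840)*m2*m1*m1*m1*m1*m1 + (151481988503/990904320)*m3*m1*m1*m1*m1 + (7972736237/61931520)*m1*m1*m1*m1*m1*m1*m1 + (368821123/9175040)*m2*m2*m2*m1*m1 + (-817820751/36700160)*m4*m2*m1*m1 + (16035701/5242880)*m6*m1*m1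 + (-144321309/458752)*m2*m2*m1*m1*m1*m1 + (593320937/4587520)*m3*m2*m1*m1*m1 + (625392339/9175040)*m4*m1*m1*m1*m1 + (-48107103/2621440)*m5*m1*m1*m1 + (-368821123/55050240)*m3*m3*m1*m1 + (16035701/35840)*m2*m1*m1*m1*m1*m1*m1 + (-304678319/1720320)*m3*m1*m1*m1*m1*m1 + (-16035701/107520)*m1*m1*m1*m1*m1*m1*m1*m1 := by
  simp only [reD, rD, polyL3]
  ring

lemma final_identity (m1 m2 m3 m4 m5 m6 m7 m8 : ℝ) : e8m m1 m2 m3 m4 m5 m6 m7 m8 + 1 / 80 =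
    reA m1 m2 m3 m4 m5 m6 m7 m8 + reC m1 m2 m3 m4 m5 m6 m7 m8 + reD m1 m2 m3 m4 m5 m6 m7 m8 + reB m1 m2 m3 m4 m5 m6 m7 m8 := by
  rw [reA_eq, reB_eq, reC_eq, reD_eq, e8m]
  ring

theorem product_plus_one_over_eighty_in_module :
    InQuadModule 8 4 ((∏ i : Fin 8, X i) + C (1 / 80 : ℝ)) := by
  have h0 : SOSd 4 (sigA + sigC + sigD) := (sos_sigA.add sos_sigC).add sos_sigD
  have h1 : ∀ i, SOSd 3 (C (1 / 8) * sigB i) := fun i => (sos_sigB i).smul _ (by norm_num)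
  refine ⟨sigA + sigC + sigD, fun i => C (1 / 8) * sigB i, h0.isSOS, fun i => (h1 i).isSOS,
    h0.degree, fun i => (h1 i).degree, ?_⟩
  refine MvPolynomial.funext fun x => ?_
  have hB := eval_sigB x
  simp only [map_add, map_sub, map_mul, map_sum, map_prod, map_pow, eval_X, eval_C, eval_sigA,
    eval_sigC, eval_sigD, mul_assoc, ← Finset.mul_sum]
  rw [hB, prod_e8m]
  exact final_identity _ _ _ _ _ _ _ _
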